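/- arXiv:0904.2955 — 2 statements merged into one kernel-verified Lean document; each statement's English description precedes it below -/
import Mathlib

section
/- If a λ-term t is strongly normalizing for β-reduction alone, then t is strongly normalizing for the combined reduction generated by the rules β, δ, γ and assoc. -/
/-- Untyped λ-terms in de Bruijn representation. -/
inductive Lam : Type
  | var : ℕ → Lam
  | lam : Lam → Lam
  | app : Lam → Lam → Lam

namespace Lam

/-- Renaming of de Bruijn indices (extended under binders). -/
def rename (f : ℕ → ℕ) : Lam → Lam
  | var n => var (f n)
  | lam b => lam (rename (fun n => match n with | 0 => 0 | m+1 => f m + 1) b)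
  | app a b => app (rename f a) (rename f b)

/-- Shift all free indices up by one. -/
def shift : Lam → Lam := rename Nat.succ

/-- Swap the two innermost free indices. -/
def swap01 : Lam → Lam := rename (fun n => match n with | 0 => 1 | 1 => 0 | m => m)

/-- Capture-avoiding substitution of `u` for the free variable (index) `k`. -/
def subst : Lam → ℕ → Lam → Lam
  | var n, k, u => if n = k then u else if k < n then var (n-1) else var n
  | lam b, k, u => lam (subst b (k+1) (shift u))
  | app a b, k, u => app (subst a k u) (subst b k u)

/-- The names of the four reduction rules. -/
inductive Rule | beta | delta | gamma | assoc

/-- One-step reduction by a given rule, closed under all term contexts.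
β : (λx.M) N ▷ M[x:=N]
δ : (λy.λx.M) N ▷ λx.((λy.M) N)   (x ∉ FV N)
γ : ((λx.M) N) P ▷ (λx.(M P)) N   (x ∉ FV P)
assoc : M ((λx.N) P) ▷ (λx.(M N)) P   (x ∉ FV M) -/
inductive StepR : Rule → Lam → Lam → Prop
  | beta (M N) : StepR .beta (app (lam M) N) (subst M 0 N)
  | delta (M N) : StepR .delta (app (lam (lam M)) N) (lam (app (lam (swap01 M)) (shift N)))
  | gamma (M N P) : StepR .gamma (app (app (lam M) N) P) (app (lam (app M (shift P))) N)
  | assoc (M N P) : StepR .assoc (app M (app (lam N) P)) (app (lam (app (shift M) N)) P)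
  | appL {r M M'} (N) : StepR r M M' → StepR r (app M N) (app M' N)
  | appR {r N N'} (M) : StepR r N N' → StepR r (app M N) (app M N')
  | under {r M M'} : StepR r M M' → StepR r (lam M) (lam M')

/-- One-step reduction by any of β, δ, γ, assoc. -/
def Step (t t' : Lam) : Prop := ∃ r, StepR r t t'

/-- One-step β-reduction alone. -/
def StepBeta : Lam → Lam → Prop := StepR Rule.beta

/-- `t` is strongly normalizing for the reduction relation `R`:
every `R`-reduction sequence from `t` is finite. -/
def SN (R : Lam → Lam → Prop) (t : Lam) : Prop := Acc (fun a b => R b a) t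

/-- Left-nested application `(H M₁ … Mₙ)`. -/
def apps : Lam → List Lam → Lam
  | H, [] => H
  | H, M :: Ms => apps (app H M) Ms

/-- Types of system 𝒟 : atoms, arrow and intersection. -/
inductive Ty : Type
  | atom : ℕ → Ty
  | arrow : Ty → Ty → Ty
  | inter : Ty → Ty → Ty

/-- Typing judgment of system 𝒟 (contexts are lists of types, de Bruijn style). -/
inductive Typed : List Ty → Lam → Ty → Prop
  | var {Γ n A} : Γ[n]? = some A → Typed Γ (var n) A
  | app {Γ M N A B} : Typed Γ M (.arrow A B) → Typed Γ N A → Typed Γ (app M N) B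
  | lam {Γ M A B} : Typed (A :: Γ) M B → Typed Γ (lam M) (.arrow A B)
  | interI {Γ M A B} : Typed Γ M A → Typed Γ M B → Typed Γ M (.inter A B)
  | interE1 {Γ M A B} : Typed Γ M (.inter A B) → Typed Γ M A
  | interE2 {Γ M A B} : Typed Γ M (.inter A B) → Typed Γ M B

/-- A term is typable in system 𝒟 if it has a type in some context. -/
def Typable (t : Lam) : Prop := ∃ Γ A, Typed Γ t A

end Lam

namespace Lam

/-! ### Simultaneous substitution -/

/-- Extension of a renaming under a binder. -/
def liftRen (f : ℕ → ℕ) : ℕ → ℕ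
  | 0 => 0
  | m + 1 => f m + 1

theorem rename_lam (f : ℕ → ℕ) (b : Lam) : rename f (lam b) = lam (rename (liftRen f) b) := by
  have : (fun n => match n with | 0 => 0 | m + 1 => f m + 1) = liftRen f := by
    funext n; cases n <;> rfl
  rw [← this]; rfl

/-- Extension of a simultaneous substitution under a binder. -/
def up (σ : ℕ → Lam) : ℕ → Lam
  | 0 => var 0
  | n + 1 => shift (σ n)

/-- Simultaneous capture-avoiding substitution. -/
def inst (σ : ℕ → Lam) : Lam → Lam
  | var n => σ n
  | lam b => lam (inst (up σ) b)
  | app a b => app (inst σ a) (inst σ b)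

/-- The simultaneous substitution performed by `subst · k u`. -/
def single (k : ℕ) (u : Lam) (n : ℕ) : Lam :=
  if n = k then u else if k < n then var (n - 1) else var n

theorem rename_rename (f g : ℕ → ℕ) (t : Lam) :
    rename g (rename f t) = rename (g ∘ f) t := by
  induction t generalizing f g with
  | var n => rfl
  | lam b ih =>
    have : liftRen g ∘ liftRen f = liftRen (g ∘ f) := by funext n; cases n <;> rfl
    simp only [rename_lam, ih, this]
  | app a b iha ihb => simp only [rename, iha, ihb]

theorem inst_rename (f : ℕ → ℕ) (σ : ℕ → Lam) (t : Lam) :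
    inst σ (rename f t) = inst (σ ∘ f) t := by
  induction t generalizing f σ with
  | var n => rfl
  | lam b ih =>
    have : up σ ∘ liftRen f = up (σ ∘ f) := by funext n; cases n <;> rfl
    simp only [rename_lam, inst, ih, this]
  | app a b iha ihb => simp only [rename, inst, iha, ihb]

theorem rename_inst (f : ℕ → ℕ) (σ : ℕ → Lam) (t : Lam) :
    rename f (inst σ t) = inst (rename f ∘ σ) t := by
  induction t generalizing f σ with
  | var n => rfl
  | lam b ih =>
    have : rename (liftRen f) ∘ up σ = up (rename f ∘ σ) := by
      funext n
      cases n with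
      | zero => rfl
      | succ n => simp only [Function.comp, up, shift, rename_rename]; rfl
    simp only [rename_lam, inst, ih, this]
  | app a b iha ihb => simp only [rename, inst, iha, ihb]

theorem inst_up_shift (σ : ℕ → Lam) (t : Lam) : inst (up σ) (shift t) = shift (inst σ t) := by
  simp only [shift, inst_rename, rename_inst]; rfl

theorem inst_inst (σ τ : ℕ → Lam) (t : Lam) : inst τ (inst σ t) = inst (inst τ ∘ σ) t := by
  induction t generalizing σ τ with
  | var n => rfl
  | lam b ih =>
    have : inst (up τ) ∘ up σ = up (inst τ ∘ σ) := by
      funext n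
      cases n with
      | zero => rfl
      | succ n => exact inst_up_shift τ (σ n)
    simp only [inst, ih, this]
  | app a b iha ihb => simp only [inst, iha, ihb]

theorem inst_var (t : Lam) : inst var t = t := by
  induction t with
  | var n => rfl
  | lam b ih =>
    have : up var = var := by funext n; cases n <;> rfl
    simp only [inst, this, ih]
  | app a b iha ihb => simp only [inst, iha, ihb]

theorem rename_eq_inst (f : ℕ → ℕ) (t : Lam) : rename f t = inst (var ∘ f) t := by
  have := rename_inst f var t
  rwa [inst_var] at this

theorem up_single (k : ℕ) (u : Lam) : up (single k u) = single (k + 1) (shift u) := by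
  funext n
  rcases n with _ | n
  · simp [up, single]
  · by_cases h : n = k
    · simp [up, single, h]
    · by_cases h' : k < n
      · obtain ⟨m, rfl⟩ : ∃ m, n = m + 1 := ⟨n - 1, by omega⟩
        have : k ≤ m := by omega
        simp [up, single, h, this, shift, rename]
      · simp [up, single, h, h', shift, rename]

theorem subst_eq_inst (t : Lam) (k : ℕ) (u : Lam) : subst t k u = inst (single k u) t := by
  induction t generalizing k u with
  | var n => rfl
  | lam b ih => simp only [subst, inst, ih, up_single]
  | app a b iha ihb => simp only [subst, inst, iha, ihb]

theorem subst_shift (t u : Lam) : subst (shift t) 0 u = t := by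
  rw [subst_eq_inst, shift, inst_rename]
  exact inst_var t

theorem inst_subst (σ : ℕ → Lam) (t u : Lam) :
    inst σ (subst t 0 u) = subst (inst (up σ) t) 0 (inst σ u) := by
  simp only [subst_eq_inst, inst_inst]
  congr 1
  funext n
  cases n with
  | zero => rfl
  | succ n =>
    have := subst_shift (σ n) (inst σ u)
    rw [subst_eq_inst] at this
    exact this.symm

theorem inst_swap01 (σ : ℕ → Lam) (t : Lam) :
    inst (up (up σ)) (swap01 t) = swap01 (inst (up (up σ)) t) := by
  simp only [swap01, inst_rename, rename_inst]
  congr 1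
  funext n
  rcases n with _ | _ | n
  · rfl
  · rfl
  · simp only [Function.comp, up, shift, rename_rename]; rfl

theorem up_var_comp (f : ℕ → ℕ) : up (var ∘ f) = var ∘ liftRen f := by
  funext n; cases n <;> rfl

theorem rename_subst (f : ℕ → ℕ) (t u : Lam) :
    rename f (subst t 0 u) = subst (rename (liftRen f) t) 0 (rename f u) := by
  simp only [rename_eq_inst, ← up_var_comp, inst_subst]

theorem subst_swap01 (t u : Lam) : subst (swap01 t) 0 u = subst t 1 u := by
  simp only [subst_eq_inst, swap01, inst_rename]
  congr 1
  funext n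
  rcases n with _ | _ | n
  · simp [single]
  · simp [single]
  · simp [single]

theorem subst_subst_swap01 (t u v : Lam) :
    subst (subst (swap01 t) 1 (shift v)) 0 u = subst (subst t 1 (shift u)) 0 v := by
  simp only [subst_eq_inst, swap01, inst_rename, inst_inst]
  congr 1
  have h (a b : Lam) : inst (single 0 a) (shift b) = b := by
    rw [← subst_eq_inst, subst_shift]
  funext n
  rcases n with _ | _ | n
  · simp [single, h, inst]
  · simp [single, h, inst]
  · simp [single, inst]

/-! ### Contextual closure -/

/-- The four reduction rules applied at the root. -/
inductive Root : Rule → Lam → Lam → Prop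
  | beta (M N) : Root .beta (app (lam M) N) (subst M 0 N)
  | delta (M N) : Root .delta (app (lam (lam M)) N) (lam (app (lam (swap01 M)) (shift N)))
  | gamma (M N P) : Root .gamma (app (app (lam M) N) P) (app (lam (app M (shift P))) N)
  | assoc (M N P) : Root .assoc (app M (app (lam N) P)) (app (lam (app (shift M) N)) P)

theorem StepR.inst {r : Rule} {t t' : Lam} (h : StepR r t t') (σ : ℕ → Lam) :
    StepR r (inst σ t) (inst σ t') := by
  induction h generalizing σ with
  | beta M N => rw [inst_subst]; exact .beta _ _
  | delta M N => simp only [Lam.inst, inst_swap01, inst_up_shift]; exact .delta _ _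
  | gamma M N P => simp only [Lam.inst, inst_up_shift]; exact .gamma _ _ _
  | assoc M N P => simp only [Lam.inst, inst_up_shift]; exact .assoc _ _ _
  | appL N _ ih => exact .appL _ (ih σ)
  | appR M _ ih => exact .appR _ (ih σ)
  | under _ ih => exact .under (ih (up σ))

open Relation in
theorem reflTransGen_inst {r : Rule} {σ τ : ℕ → Lam}
    (h : ∀ n, ReflTransGen (StepR r) (σ n) (τ n)) (t : Lam) :
    ReflTransGen (StepR r) (inst σ t) (inst τ t) := by
  induction t generalizing σ τ with
  | var n => exact h n
  | lam b ih =>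
    refine (ih (σ := up σ) (τ := up τ) fun n => ?_).lift lam fun _ _ => .under
    cases n with
    | zero => exact .refl
    | succ n =>
      refine (h n).lift shift fun a b hab => ?_
      simp only [Function.onFun, shift, rename_eq_inst]
      exact hab.inst _
  | app a b iha ihb =>
    exact ((iha h).lift (app · _) fun _ _ => .appL _).trans
      ((ihb h).lift (app _) fun _ _ => .appR _)

open Relation in
theorem reflTransGen_subst {r : Rule} {u u' : Lam} (h : StepR r u u') (t : Lam) :
    ReflTransGen (StepR r) (subst t 0 u) (subst t 0 u') := by
  simp only [subst_eq_inst]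
  refine reflTransGen_inst (fun n => ?_) t
  cases n with
  | zero => exact .single h
  | succ n => exact .refl

/-! ### A cost for perpetual evaluation

`Eval H S n` evaluates `H` applied to the stack of arguments `S`, contracting head redexes and
evaluating every argument, including those consumed by a redex; `n` counts the contractions. -/

/-- Perpetual evaluation of the term `H` against the stack `S`, at cost `n`. -/
inductive Eval : Lam → List Lam → ℕ → Prop
  | nil (x) : Eval (var x) [] 0
  | cons {x N S k n} : Eval N [] k → Eval (var x) S n → Eval (var x) (N :: S) (k + n)
  | app {M N S n} : Eval M (N :: S) n → Eval (app M N) S n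
  | lam {M n} : Eval M [] n → Eval (lam M) [] n
  | beta {M N S k n} : Eval N [] k → Eval (subst M 0 N) S n → Eval (lam M) (N :: S) (k + n + 1)

theorem Eval.rename {H : Lam} {S : List Lam} {n : ℕ} (h : Eval H S n) (f : ℕ → ℕ) :
    Eval (rename f H) (S.map (rename f)) n := by
  induction h generalizing f with
  | nil x => exact .nil _
  | cons _ _ ih₁ ih₂ => exact .cons (ih₁ f) (ih₂ f)
  | app _ ih => exact .app (ih f)
  | lam _ ih => rw [rename_lam]; exact .lam (ih _)
  | beta _ _ ih₁ ih₂ =>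
    rw [rename_lam]
    refine .beta (ih₁ f) ?_
    rw [← rename_subst]
    exact ih₂ f

/-- Reduction of one element of a stack. -/
inductive StackStep (r : Rule) : List Lam → List Lam → Prop
  | head {N N'} (S) : StepR r N N' → StackStep r (N :: S) (N' :: S)
  | tail {S S'} (N) : StackStep r S S' → StackStep r (N :: S) (N :: S')

/-- `n` bounds `m`, strictly so for β. -/
def Below (r : Rule) (m n : ℕ) : Prop := m ≤ n ∧ (r = .beta → m < n)

/-- Root reductions by `r` do not increase the cost, and decrease it if `r` is β. -/
def RootBelow (r : Rule) : Prop :=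
  ∀ {t t' S n}, Root r t t' → Eval t S n → ∃ m, Below r m n ∧ Eval t' S m

open Relation in
theorem Eval.step_aux {r : Rule} (hr : RootBelow r) (B : ℕ) :
    ∀ {H S n}, Eval H S n → n ≤ B →
      (∀ {H'}, StepR r H H' → ∃ m, Below r m n ∧ Eval H' S m) ∧
      (∀ {S'}, StackStep r S S' → ∃ m, Below r m n ∧ Eval H S' m) := by
  induction B using Nat.strong_induction_on with
  | _ B IH =>
  have many {H H' S n} (hn : n < B) (h : Eval H S n) (hs : ReflTransGen (StepR r) H H') :
      ∃ m ≤ n, Eval H' S m := by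
    induction hs with
    | refl => exact ⟨n, le_rfl, h⟩
    | tail _ hs ih =>
      obtain ⟨m, hm, h⟩ := ih
      obtain ⟨m', hm', h'⟩ := (IH m (by omega) h le_rfl).1 hs
      exact ⟨m', hm'.1.trans hm, h'⟩
  intro H S n h
  induction h with
  | nil x =>
    refine fun _ => ⟨fun hs => ?_, fun hs => nomatch hs⟩
    cases hs
  | @cons x N S k n hN hS ihN ihS =>
    refine fun hB => ⟨fun hs => (nomatch hs), fun hs => ?_⟩
    cases hs with
    | head _ hs =>
      obtain ⟨m, hm, h⟩ := (ihN (by omega)).1 hs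
      refine ⟨_, ?_, .cons h hS⟩
      exact ⟨by have := hm.1; omega, fun e => by have := hm.2 e; omega⟩
    | tail _ hs =>
      obtain ⟨m, hm, h⟩ := (ihS (by omega)).2 hs
      refine ⟨_, ?_, .cons hN h⟩
      exact ⟨by have := hm.1; omega, fun e => by have := hm.2 e; omega⟩
  | @app M N S n h ih =>
    refine fun hB => ⟨fun hs => ?_, fun hs => ?_⟩
    · have left {M'} (hs : StepR r M M') : ∃ m, Below r m n ∧ Eval (Lam.app M' N) S m :=
        let ⟨m, hm, h⟩ := (ih hB).1 hs; ⟨m, hm, .app h⟩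
      have right {N'} (hs : StepR r N N') : ∃ m, Below r m n ∧ Eval (Lam.app M N') S m :=
        let ⟨m, hm, h⟩ := (ih hB).2 (.head S hs); ⟨m, hm, .app h⟩
      cases hs with
      | appL _ hs => exact left hs
      | appR _ hs => exact right hs
      | beta => exact hr (.beta _ _) (.app h)
      | delta => exact hr (.delta _ _) (.app h)
      | gamma => exact hr (.gamma _ _ _) (.app h)
      | assoc => exact hr (.assoc _ _ _) (.app h)
    · obtain ⟨m, hm, h⟩ := (ih hB).2 (.tail N hs)
      exact ⟨m, hm, .app h⟩
  | lam h ih =>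
    refine fun hB => ⟨fun hs => ?_, fun hs => nomatch hs⟩
    cases hs with
    | under hs =>
      obtain ⟨m, hm, h⟩ := (ih hB).1 hs
      exact ⟨m, hm, .lam h⟩
  | @beta M N S k n hN hM ihN ihM =>
    refine fun hB => ⟨fun hs => ?_, fun hs => ?_⟩
    · cases hs with
      | @under _ _ M' hs =>
        have hs' : StepR r (subst M 0 N) (subst M' 0 N) := by
          simp only [subst_eq_inst]; exact hs.inst _
        obtain ⟨m, hm, h⟩ := (ihM (by omega)).1 hs'
        refine ⟨_, ?_, .beta hN h⟩
        exact ⟨by have := hm.1; omega, fun e => by have := hm.2 e; omega⟩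
    · cases hs with
      | head _ hs =>
        obtain ⟨m, hm, h⟩ := (ihN (by omega)).1 hs
        obtain ⟨m', hm', h'⟩ := many (by omega) hM (reflTransGen_subst hs M)
        refine ⟨_, ?_, .beta h h'⟩
        exact ⟨by have := hm.1; omega, fun e => by have := hm.2 e; omega⟩
      | tail _ hs =>
        obtain ⟨m, hm, h⟩ := (ihM (by omega)).2 hs
        refine ⟨_, ?_, .beta hN h⟩
        exact ⟨by have := hm.1; omega, fun e => by have := hm.2 e; omega⟩

theorem Eval.step {r : Rule} (hr : RootBelow r) {H H' : Lam} {S : List Lam} {n : ℕ}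
    (h : Eval H S n) (hs : StepR r H H') : ∃ m, Below r m n ∧ Eval H' S m :=
  (Eval.step_aux hr n h le_rfl).1 hs

theorem rootBelow_beta : RootBelow .beta := by
  rintro t t' S n ⟨⟩ h
  cases h with
  | app h =>
    cases h with
    | beta _ h => exact ⟨_, ⟨by omega, fun _ => by omega⟩, h⟩

theorem rootBelow_gamma : RootBelow .gamma := by
  rintro t t' S n ⟨⟩ h
  cases h with
  | app h =>
  cases h with
  | app h =>
  cases h with
  | beta hN h =>
    refine ⟨_, ⟨le_rfl, nofun⟩, .app (.beta hN (.app ?_))⟩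
    rwa [subst_shift]

theorem rootBelow_delta : RootBelow .delta := by
  rintro t t' S n hs h
  cases hs with
  | delta M N =>
  cases h with
  | app h =>
  cases h with
  | beta hN h =>
  cases h with
  | lam h =>
    refine ⟨_, ⟨le_rfl, nofun⟩, .lam (.app (.beta (hN.rename _) ?_))⟩
    rwa [subst_swap01]
  | @beta _ P _ _ _ hP h =>
    rw [zero_add, ← subst_subst_swap01] at h
    rw [← subst_shift N P] at hN h
    exact ⟨_, ⟨by omega, nofun⟩, .beta hP (.app (.beta hN h))⟩

open Relation in
/-- Pulling a redex out of the stack does not increase the cost. -/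
theorem Eval.pull_redex {H N P : Lam} {S₁ S₂ : List Lam} {n : ℕ}
    (h : Eval H (S₁ ++ .app (.lam N) P :: S₂) n) :
    ∃ k m, k + m + 1 ≤ n ∧ Eval P [] k ∧ Eval H (S₁ ++ subst N 0 P :: S₂) m := by
  generalize hS : S₁ ++ Lam.app (.lam N) P :: S₂ = S at h
  induction h generalizing S₁ with
  | nil x => simp at hS
  | @cons x Q S k n hQ hx _ ih =>
    cases S₁ with
    | nil =>
      obtain ⟨rfl, rfl⟩ := List.cons.inj hS
      cases hQ with
      | app h =>
      cases h with
      | beta hP hN => exact ⟨_, _, by omega, hP, .cons hN hx⟩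
    | cons _ S₁ =>
      obtain ⟨rfl, rfl⟩ := List.cons.inj hS
      obtain ⟨k', m, hle, hP, h⟩ := ih rfl
      exact ⟨k', _, by omega, hP, .cons hQ h⟩
  | @app M Q S n _ ih =>
    obtain ⟨k, m, hle, hP, h⟩ := ih (S₁ := Q :: S₁) (by rw [← hS]; rfl)
    exact ⟨k, m, hle, hP, .app h⟩
  | lam => simp at hS
  | @beta M Q S k n hQ hM _ ih =>
    cases S₁ with
    | nil =>
      obtain ⟨rfl, rfl⟩ := List.cons.inj hS
      have many {H'} (hs : ReflTransGen (StepR .beta)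
          (subst M 0 (.app (.lam N) P)) H') : ∃ m ≤ n, Eval H' S₂ m := by
        induction hs with
        | refl => exact ⟨n, le_rfl, hM⟩
        | tail _ hs ih =>
          obtain ⟨m, hm, h⟩ := ih
          obtain ⟨m', hm', h'⟩ := h.step rootBelow_beta hs
          exact ⟨m', hm'.1.trans hm, h'⟩
      obtain ⟨m, hm, h⟩ := many (reflTransGen_subst (.beta N P) M)
      cases hQ with
      | app hQ =>
      cases hQ with
      | beta hP hN => exact ⟨_, _, by omega, hP, .beta hN h⟩
    | cons _ S₁ =>
      obtain ⟨rfl, rfl⟩ := List.cons.inj hS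
      obtain ⟨k', m, hle, hP, h⟩ := ih rfl
      exact ⟨k', _, by omega, hP, .beta hQ h⟩

theorem rootBelow_assoc : RootBelow .assoc := by
  rintro t t' S n ⟨⟩ h
  cases h with
  | app h =>
    obtain ⟨k, m, hle, hP, h⟩ := h.pull_redex (S₁ := [])
    refine ⟨_, ⟨hle, nofun⟩, .app (.beta hP (.app ?_))⟩
    rwa [subst_shift]

theorem rootBelow (r : Rule) : RootBelow r := by
  cases r
  exacts [rootBelow_beta, rootBelow_delta, rootBelow_gamma, rootBelow_assoc]

/-! ### β-strongly normalizing terms have a cost -/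

/-- `s` is a subterm of `t`. -/
inductive Subterm : Lam → Lam → Prop
  | refl (t) : Subterm t t
  | appL {s M} (N) : Subterm s M → Subterm s (app M N)
  | appR {s N} (M) : Subterm s N → Subterm s (app M N)
  | lam {s M} : Subterm s M → Subterm s (lam M)

theorem Subterm.trans {s t u : Lam} (h : Subterm s t) (h' : Subterm t u) : Subterm s u := by
  induction h' with
  | refl => exact h
  | appL N _ ih => exact .appL N ih
  | appR M _ ih => exact .appR M ih
  | lam _ ih => exact .lam ih

theorem Subterm.lift_step {s s' t : Lam} (h : Subterm s t) (hs : StepBeta s s') :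
    ∃ t', StepBeta t t' ∧ Subterm s' t' := by
  induction h with
  | refl => exact ⟨s', hs, .refl _⟩
  | appL N _ ih =>
    obtain ⟨t', ht, h⟩ := ih
    exact ⟨_, .appL N ht, .appL N h⟩
  | appR M _ ih =>
    obtain ⟨t', ht, h⟩ := ih
    exact ⟨_, .appR M ht, .appR M h⟩
  | lam _ ih =>
    obtain ⟨t', ht, h⟩ := ih
    exact ⟨_, .under ht, .lam h⟩

theorem Subterm.head_apps (H : Lam) (S : List Lam) : Subterm H (apps H S) := by
  induction S generalizing H with
  | nil => exact .refl _
  | cons N S ih => exact (Subterm.appL N (.refl H)).trans (ih _)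

theorem Subterm.apps_of_mem {N : Lam} {S : List Lam} (h : N ∈ S) (H : Lam) :
    Subterm N (apps H S) := by
  induction S generalizing H with
  | nil => simp at h
  | cons M S ih =>
    rcases List.mem_cons.1 h with rfl | h
    · exact (Subterm.appR H (.refl N)).trans (head_apps _ S)
    · exact ih h _

theorem StepR.apps {r : Rule} {H H' : Lam} (h : StepR r H H') (S : List Lam) :
    StepR r (apps H S) (apps H' S) := by
  induction S generalizing H H' with
  | nil => exact h
  | cons N S ih => exact ih (.appL N h)

theorem Eval.exists_var (x : ℕ) {S : List Lam} (h : ∀ N ∈ S, ∃ n, Eval N [] n) :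
    ∃ n, Eval (var x) S n := by
  induction S with
  | nil => exact ⟨_, .nil x⟩
  | cons N S ih =>
    obtain ⟨k, hk⟩ := h N (by simp)
    obtain ⟨n, hn⟩ := ih fun M hM => h M (by simp [hM])
    exact ⟨_, .cons hk hn⟩

theorem sizeOf_le_apps (H : Lam) (S : List Lam) : sizeOf H ≤ sizeOf (apps H S) := by
  induction S generalizing H with
  | nil => exact le_rfl
  | cons N S ih => exact le_trans (by simp +arith) (ih (app H N))

theorem sizeOf_lt_apps {N : Lam} {S : List Lam} (h : N ∈ S) (H : Lam) :
    sizeOf N < sizeOf (apps H S) := by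
  induction S generalizing H with
  | nil => simp at h
  | cons M S ih =>
    rcases List.mem_cons.1 h with rfl | h
    · exact lt_of_lt_of_le (by simp +arith) (sizeOf_le_apps (app H N) S)
    · exact ih h _

theorem Eval.exists_of_sn {t : Lam} (ht : SN StepBeta t) :
    ∀ {H S}, Subterm (apps H S) t → ∃ n, Eval H S n := by
  induction ht with
  | intro t _ IH =>
  have main : ∀ (B : ℕ) {H S}, sizeOf (apps H S) ≤ B → Subterm (apps H S) t →
      ∃ n, Eval H S n := by
    intro B
    induction B using Nat.strong_induction_on with
    | _ B IHB =>
    have args {H S N} (hB : sizeOf (apps H S) ≤ B) (hS : Subterm (apps H S) t) (hN : N ∈ S) :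
        ∃ n, Eval N [] n :=
      IHB _ ((sizeOf_lt_apps hN H).trans_le hB) (H := N) (S := []) le_rfl
        ((Subterm.apps_of_mem hN H).trans hS)
    intro H
    induction H with
    | var x => exact fun hB hS => exists_var x fun N hN => args hB hS hN
    | app M N ihM _ =>
      intro S hB hS
      obtain ⟨n, hn⟩ := ihM (S := N :: S) hB hS
      exact ⟨n, .app hn⟩
    | lam M ihM =>
      rintro (_ | ⟨N, S⟩) hB hS
      · obtain ⟨n, hn⟩ := ihM (S := []) (by simp [apps] at hB ⊢; omega)
          ((Subterm.lam (.refl M)).trans hS)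
        exact ⟨n, .lam hn⟩
      · obtain ⟨k, hk⟩ := args hB hS (List.mem_cons_self ..)
        have hs : StepBeta (apps (.lam M) (N :: S)) (apps (subst M 0 N) S) :=
          (StepR.beta M N).apps S
        obtain ⟨t', ht', hsub⟩ := hS.lift_step hs
        obtain ⟨n, hn⟩ := IH t' ht' hsub
        exact ⟨_, .beta hk hn⟩
  intro H S hS
  exact main _ le_rfl hS

/-! ### Termination of the permutation rules -/

/-- A measure decreased by the permutation rules δ, γ and assoc. -/
def weight : Lam → ℕ
  | var _ => 2
  | lam b => weight b + 1
  | app a b => weight a * weight b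

theorem two_le_weight (t : Lam) : 2 ≤ weight t := by
  induction t with
  | var n => exact le_rfl
  | lam b ih => exact ih.trans (Nat.le_succ _)
  | app a b iha ihb => simp only [weight]; nlinarith

theorem weight_rename (f : ℕ → ℕ) (t : Lam) : weight (rename f t) = weight t := by
  induction t generalizing f with
  | var n => rfl
  | lam b ih => rw [rename_lam, weight, weight, ih]
  | app a b iha ihb => simp only [rename, weight, iha, ihb]

theorem StepR.weight_lt {r : Rule} {t t' : Lam} (h : StepR r t t') (hr : r ≠ .beta) :
    weight t' < weight t := by
  induction h with
  | beta => exact absurd rfl hr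
  | delta M N =>
    have := two_le_weight N
    simp only [weight, swap01, shift, weight_rename]
    nlinarith
  | gamma M N P =>
    have := two_le_weight N
    have := two_le_weight P
    simp only [weight, shift, weight_rename]
    nlinarith
  | assoc M N P =>
    have := two_le_weight M
    have := two_le_weight P
    simp only [weight, shift, weight_rename]
    nlinarith
  | appL N _ ih =>
    exact Nat.mul_lt_mul_of_pos_right (ih hr) (by have := two_le_weight N; omega)
  | appR M _ ih =>
    exact Nat.mul_lt_mul_of_pos_left (ih hr) (by have := two_le_weight M; omega)
  | under _ ih => exact Nat.succ_lt_succ (ih hr)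

theorem Eval.sn {t : Lam} {n : ℕ} (h : Eval t [] n) : SN Step t := by
  induction n using Nat.strong_induction_on generalizing t with
  | _ n IHn =>
  induction hw : weight t using Nat.strong_induction_on generalizing t with
  | _ w IHw =>
  refine ⟨_, fun t' ⟨r, hs⟩ => ?_⟩
  obtain ⟨m, hm, h'⟩ := h.step (rootBelow r) hs
  rcases hm.1.lt_or_eq with hlt | rfl
  · exact IHn m hlt h'
  · have hr : r ≠ .beta := fun e => lt_irrefl _ (hm.2 e)
    exact IHw _ (hw ▸ hs.weight_lt hr) h' rfl

end Lam

open Lam in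
/-- If a λ-term `t` is strongly normalizing for β-reduction alone,
then `t` is strongly normalizing for the combined reduction generated by
β, δ, γ and assoc. -/
theorem sn_beta_implies_sn_all (t : Lam) (h : SN StepBeta t) : SN Step t := by
  obtain ⟨n, hn⟩ := Eval.exists_of_sn h (H := t) (S := []) (.refl t)
  exact hn.sn
end

section
/- If a λ-term t is strongly normalizing for β-reduction, then t is typable in system 𝒟. -/
namespace Lam

theorem Typed.var_succ {Γ : List Ty} {n : ℕ} {A : Ty} (B : Ty) (h : Typed Γ (Lam.var n) A) :
    Typed (B :: Γ) (Lam.var (n + 1)) A := by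
  generalize hM : Lam.var n = M at h
  induction h with
  | var h => cases hM; exact .var (by simpa using h)
  | app => cases hM
  | lam => cases hM
  | interI _ _ ih₁ ih₂ => exact .interI (ih₁ hM) (ih₂ hM)
  | interE1 _ ih => exact .interE1 (ih hM)
  | interE2 _ ih => exact .interE2 (ih hM)

/-- `Δ` refines `Γ`: every declaration of `Γ` is derivable from `Δ`. -/
def Refines (Δ Γ : List Ty) : Prop := ∀ n A, Γ[n]? = some A → Typed Δ (var n) A

theorem Refines.cons {Δ Γ : List Ty} (h : Refines Δ Γ) {B C : Ty}
    (hBC : Typed (B :: Δ) (var 0) C) : Refines (B :: Δ) (C :: Γ) := by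
  rintro (_ | n) A hn
  · simp only [List.getElem?_cons_zero, Option.some.injEq] at hn
    exact hn ▸ hBC
  · exact (h n A (by simpa using hn)).var_succ B

theorem Refines.refl (Γ : List Ty) : Refines Γ Γ := fun _ _ h => .var h

theorem Refines.typed {Δ Γ : List Ty} (h : Refines Δ Γ) {M : Lam} {A : Ty}
    (hM : Typed Γ M A) : Typed Δ M A := by
  induction hM generalizing Δ with
  | var hn => exact h _ _ hn
  | app _ _ ih₁ ih₂ => exact .app (ih₁ h) (ih₂ h)
  | lam _ ih => exact .lam (ih (h.cons (.var rfl)))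
  | interI _ _ ih₁ ih₂ => exact .interI (ih₁ h) (ih₂ h)
  | interE1 _ ih => exact .interE1 (ih h)
  | interE2 _ ih => exact .interE2 (ih h)

theorem Refines.exists_common (Γ₁ Γ₂ : List Ty) : ∃ Δ, Refines Δ Γ₁ ∧ Refines Δ Γ₂ := by
  induction Γ₁ generalizing Γ₂ with
  | nil => exact ⟨Γ₂, by simp [Refines], .refl _⟩
  | cons A Γ₁ ih =>
    cases Γ₂ with
    | nil => exact ⟨A :: Γ₁, .refl _, by simp [Refines]⟩
    | cons B Γ₂ =>
      obtain ⟨Δ, h₁, h₂⟩ := ih Γ₂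
      exact ⟨.inter A B :: Δ, h₁.cons (.interE1 (.var rfl)), h₂.cons (.interE2 (.var rfl))⟩

theorem Refines.insertIdx {Γ : List Ty} {k : ℕ} (hk : k ≤ Γ.length) {B C : Ty}
    (hBC : ∀ Δ, Typed (B :: Δ) (.var 0) C) :
    Refines (Γ.insertIdx k B) (Γ.insertIdx k C) := by
  induction k generalizing Γ with
  | zero => exact (Refines.refl Γ).cons (hBC Γ)
  | succ k ih =>
    cases Γ with
    | nil => simp at hk
    | cons D Γ => exact (ih (by simpa using hk)).cons (.var rfl)

theorem Typed.of_rename {Γ Δ : List Ty} {f : ℕ → ℕ} (hf : ∀ n, Δ[f n]? = Γ[n]?)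
    {N : Lam} {A : Ty} (h : Typed Δ (rename f N) A) : Typed Γ N A := by
  generalize hM : rename f N = M at h
  induction h generalizing Γ f N with
  | var hn =>
    cases N <;> simp only [rename, Lam.var.injEq, reduceCtorEq] at hM
    subst hM
    exact .var (hf _ ▸ hn)
  | app _ _ ih₁ ih₂ =>
    cases N <;> simp only [rename, Lam.app.injEq, reduceCtorEq] at hM
    exact .app (ih₁ hf hM.1) (ih₂ hf hM.2)
  | lam _ ih =>
    cases N <;> simp only [rename, Lam.lam.injEq, reduceCtorEq] at hM
    refine .lam (ih ?_ hM)
    rintro (_ | n)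
    · rfl
    · simpa using hf n
  | interI _ _ ih₁ ih₂ => exact .interI (ih₁ hf hM) (ih₂ hf hM)
  | interE1 _ ih => exact .interE1 (ih hf hM)
  | interE2 _ ih => exact .interE2 (ih hf hM)

theorem Typed.rename {Γ Δ : List Ty} {f : ℕ → ℕ} (hf : ∀ n, Δ[f n]? = Γ[n]?)
    {N : Lam} {A : Ty} (h : Typed Γ N A) : Typed Δ (rename f N) A := by
  induction h generalizing Δ f with
  | var hn => exact .var (hf _ ▸ hn)
  | app _ _ ih₁ ih₂ => exact .app (ih₁ hf) (ih₂ hf)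
  | lam _ ih =>
    refine .lam (ih ?_)
    rintro (_ | n)
    · rfl
    · simpa using hf n
  | interI _ _ ih₁ ih₂ => exact .interI (ih₁ hf) (ih₂ hf)
  | interE1 _ ih => exact .interE1 (ih hf)
  | interE2 _ ih => exact .interE2 (ih hf)

theorem typed_shift_iff {Γ : List Ty} {B : Ty} {N : Lam} {A : Ty} :
    Typed (B :: Γ) (shift N) A ↔ Typed Γ N A :=
  ⟨.of_rename (by simp), .rename (by simp)⟩

/-- Subject expansion for substitution by a typable term. -/
theorem Typed.exists_of_subst {Γ : List Ty} {M N : Lam} {k : ℕ} {A B₀ : Ty}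
    (hk : k ≤ Γ.length) (hN : Typed Γ N B₀) (h : Typed Γ (subst M k N) A) :
    ∃ B, Typed Γ N B ∧ Typed (Γ.insertIdx k B) M A := by
  generalize hT : subst M k N = T at h
  have left {Γ : List Ty} {k : ℕ} (hk : k ≤ Γ.length) {B C M D}
      (h : Typed (Γ.insertIdx k B) M D) : Typed (Γ.insertIdx k (.inter B C)) M D :=
    (Refines.insertIdx hk fun _ => .interE1 (.var rfl)).typed h
  have right {Γ : List Ty} {k : ℕ} (hk : k ≤ Γ.length) {B C M D}
      (h : Typed (Γ.insertIdx k C) M D) : Typed (Γ.insertIdx k (.inter B C)) M D :=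
    (Refines.insertIdx hk fun _ => .interE2 (.var rfl)).typed h
  have replaced {Γ : List Ty} {k : ℕ} (hk : k ≤ Γ.length) {N A} (h : Typed Γ N A) :
      ∃ B, Typed Γ N B ∧ Typed (Γ.insertIdx k B) (.var k) A :=
    ⟨A, h, .var (by simp [List.getElem?_insertIdx_self, hk])⟩
  induction h generalizing M N k B₀ with
  | @var Γ m A hm =>
    cases M with
    | var n =>
      rcases lt_trichotomy n k with hn | rfl | hn
      · simp only [Lam.subst, hn.ne, hn.not_gt, if_false, Lam.var.injEq] at hT
        subst hT
        exact ⟨B₀, hN, .var (by rwa [List.getElem?_insertIdx_of_lt hn])⟩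
      · simp only [Lam.subst, if_true] at hT
        subst hT
        exact replaced hk (.var hm)
      · simp only [Lam.subst, hn.ne', hn, if_true, if_false, Lam.var.injEq] at hT
        subst hT
        exact ⟨B₀, hN, .var (by rwa [List.getElem?_insertIdx_of_gt hn])⟩
    | lam => simp [Lam.subst] at hT
    | app => simp [Lam.subst] at hT
  | app h₁ h₂ ih₁ ih₂ =>
    cases M with
    | var n =>
      by_cases hn : n = k
      · subst hn
        simp only [Lam.subst, if_true] at hT
        subst hT
        exact replaced hk (.app h₁ h₂)
      · simp only [Lam.subst, hn, if_false] at hT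
        split at hT <;> cases hT
    | lam => simp [Lam.subst] at hT
    | app =>
      simp only [Lam.subst, Lam.app.injEq] at hT
      obtain ⟨B, hB, h⟩ := ih₁ hk hN hT.1
      obtain ⟨C, hC, h'⟩ := ih₂ hk hN hT.2
      exact ⟨.inter B C, .interI hB hC, .app (left hk h) (right hk h')⟩
  | lam h₁ ih =>
    cases M with
    | var n =>
      by_cases hn : n = k
      · subst hn
        simp only [Lam.subst, if_true] at hT
        subst hT
        exact replaced hk (.lam h₁)
      · simp only [Lam.subst, hn, if_false] at hT
        split at hT <;> cases hT
    | app => simp [Lam.subst] at hT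
    | lam =>
      simp only [Lam.subst, Lam.lam.injEq] at hT
      obtain ⟨B, hB, h⟩ := ih (by simpa using hk) (typed_shift_iff.2 hN) hT
      exact ⟨B, typed_shift_iff.1 hB, .lam h⟩
  | interI _ _ ih₁ ih₂ =>
    obtain ⟨B, hB, h⟩ := ih₁ hk hN hT
    obtain ⟨C, hC, h'⟩ := ih₂ hk hN hT
    exact ⟨.inter B C, .interI hB hC, .interI (left hk h) (right hk h')⟩
  | interE1 _ ih =>
    obtain ⟨B, hB, h⟩ := ih hk hN hT
    exact ⟨B, hB, .interE1 h⟩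
  | interE2 _ ih =>
    obtain ⟨B, hB, h⟩ := ih hk hN hT
    exact ⟨B, hB, .interE2 h⟩

theorem Typed.app_congr_left {Γ : List Ty} {T T' P : Lam} {A : Ty}
    (hT : ∀ B, Typed Γ T B → Typed Γ T' B) (h : Typed Γ (Lam.app T P) A) :
    Typed Γ (Lam.app T' P) A := by
  generalize hM : Lam.app T P = M at h
  induction h with
  | var => cases hM
  | lam => cases hM
  | app h₁ h₂ => cases hM; exact .app (hT _ h₁) h₂
  | interI _ _ ih₁ ih₂ => exact .interI (ih₁ hT hM) (ih₂ hT hM)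
  | interE1 _ ih => exact .interE1 (ih hT hM)
  | interE2 _ ih => exact .interE2 (ih hT hM)

/-- `HeadStep N t t'`: `t'` is obtained from `t` by contracting a redex with argument `N`
at the head of the application spine of `t`. -/
inductive HeadStep (N : Lam) : Lam → Lam → Prop
  | beta (M) : HeadStep N (app (lam M) N) (subst M 0 N)
  | app {t t'} (P) : HeadStep N t t' → HeadStep N (app t P) (app t' P)

theorem HeadStep.stepBeta {N t t' : Lam} (h : HeadStep N t t') : StepBeta t t' := by
  induction h with
  | beta M => exact .beta M N
  | app P _ ih => exact .appL P ih

theorem HeadStep.typed_expand {N t t' : Lam} (h : HeadStep N t t') {Γ : List Ty} {A B : Ty}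
    (hN : Typed Γ N B) (ht' : Typed Γ t' A) : Typed Γ t A := by
  induction h generalizing A with
  | beta M =>
    obtain ⟨C, hC, hM⟩ := Typed.exists_of_subst (Nat.zero_le _) hN ht'
    exact .app (.lam hM) hC
  | app P _ ih => exact ht'.app_congr_left fun _ => ih

/-- Terms whose application spine is headed by a variable. -/
inductive Neutral : Lam → Prop
  | var (n) : Neutral (var n)
  | app {t} (P) : Neutral t → Neutral (app t P)

theorem neutral_or_headStep (a b : Lam) :
    Neutral (app a b) ∨ ∃ N t', HeadStep N (app a b) t' := by
  induction a generalizing b with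
  | var n => exact .inl (.app b (.var n))
  | lam M => exact .inr ⟨b, _, .beta M⟩
  | app c d ihc _ =>
    rcases ihc d with h | ⟨N, t', h⟩
    · exact .inl (.app b h)
    · exact .inr ⟨N, _, .app b h⟩

/-- `Subterm s t`: the term `s` occurs in `t`. -/
inductive Subterm_s2 (s : Lam) : Lam → Prop
  | refl : Subterm_s2 s s
  | lam {b} : Subterm_s2 s b → Subterm_s2 s (lam b)
  | appL {a} (b) : Subterm_s2 s a → Subterm_s2 s (app a b)
  | appR (a) {b} : Subterm_s2 s b → Subterm_s2 s (app a b)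

theorem Subterm_s2.trans {r s t : Lam} (h₁ : Subterm_s2 r s) (h₂ : Subterm_s2 s t) : Subterm_s2 r t := by
  induction h₂ with
  | refl => exact h₁
  | lam _ ih => exact .lam ih
  | appL b _ ih => exact .appL b ih
  | appR a _ ih => exact .appR a ih

theorem Subterm_s2.exists_stepBeta {s s' t : Lam} (h : Subterm_s2 s t) (hs : StepBeta s s') :
    ∃ t', StepBeta t t' ∧ Subterm_s2 s' t' := by
  induction h with
  | refl => exact ⟨s', hs, .refl⟩
  | lam _ ih =>
    obtain ⟨t', h, h'⟩ := ih
    exact ⟨_, .under h, .lam h'⟩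
  | appL b _ ih =>
    obtain ⟨t', h, h'⟩ := ih
    exact ⟨_, .appL b h, .appL b h'⟩
  | appR a _ ih =>
    obtain ⟨t', h, h'⟩ := ih
    exact ⟨_, .appR a h, .appR a h'⟩

theorem HeadStep.subterm {N a b t' : Lam} (h : HeadStep N (Lam.app a b) t') :
    Subterm_s2 N a ∨ Subterm_s2 N b := by
  generalize hT : Lam.app a b = T at h
  induction h generalizing a b with
  | beta M => cases hT; exact .inr .refl
  | @app t _ P h ih =>
    cases hT
    cases h with
    | beta M => exact .inl (.appR _ .refl)
    | app Q _ => exact .inl ((ih rfl).elim (.appL _) (.appR _))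

theorem Neutral.exists_typed {t : Lam} (h : Neutral t)
    (hsub : ∀ a b, Subterm_s2 (Lam.app a b) t → Typable b) (C : Ty) : ∃ Γ, Typed Γ t C := by
  induction h generalizing C with
  | var n => exact ⟨List.replicate (n + 1) C, .var (by simp)⟩
  | @app t P _ ih =>
    obtain ⟨Γ₁, A, hP⟩ := hsub t P .refl
    obtain ⟨Γ₂, ht⟩ := ih (fun a b h => hsub a b (.appL P h)) (.arrow A C)
    obtain ⟨Δ, h₁, h₂⟩ := Refines.exists_common Γ₁ Γ₂
    exact ⟨Δ, .app (h₂.typed ht) (h₁.typed hP)⟩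

theorem Typable.lam {b : Lam} (h : Typable b) : Typable (lam b) := by
  obtain ⟨_ | ⟨B, Γ⟩, A, h⟩ := h
  · exact ⟨[], .arrow (.atom 0) A, .lam (Refines.typed (by simp [Refines]) h)⟩
  · exact ⟨Γ, .arrow B A, .lam h⟩

theorem Typable.of_headStep {N t t' : Lam} (h : HeadStep N t t') (hN : Typable N)
    (ht' : Typable t') : Typable t := by
  obtain ⟨Γ₁, B, hN⟩ := hN
  obtain ⟨Γ₂, A, ht'⟩ := ht'
  obtain ⟨Δ, h₁, h₂⟩ := Refines.exists_common Γ₁ Γ₂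
  exact ⟨Δ, A, h.typed_expand (h₁.typed hN) (h₂.typed ht')⟩

theorem Subterm_s2.typable_of_typable_reducts {s : Lam}
    (hred : ∀ u u', Subterm_s2 u s → StepBeta u u' → Typable u') {r : Lam}
    (hr : Subterm_s2 r s) : Typable r := by
  induction s generalizing r with
  | var n =>
    cases hr
    exact ⟨List.replicate (n + 1) (.atom 0), .atom 0, .var (by simp)⟩
  | lam b ih =>
    have hb {r} := @ih (fun u u' h => hred u u' (.lam h)) r
    cases hr with
    | refl => exact (hb .refl).lam
    | lam h => exact hb h
  | app a b iha ihb =>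
    have ha {r} := @iha (fun u u' h => hred u u' (.appL b h)) r
    have hb {r} := @ihb (fun u u' h => hred u u' (.appR a h)) r
    cases hr with
    | appL _ h => exact ha h
    | appR _ h => exact hb h
    | refl =>
      rcases neutral_or_headStep a b with h | ⟨N, t', h⟩
      · obtain ⟨Γ, hΓ⟩ := h.exists_typed (fun c d hcd => by
          cases hcd with
          | refl => exact hb .refl
          | appL _ h => exact ha (.trans (.appR c .refl) h)
          | appR _ h => exact hb (.trans (.appR c .refl) h)) (.atom 0)
        exact ⟨Γ, _, hΓ⟩
      · exact .of_headStep h (h.subterm.elim ha hb) (hred _ _ .refl h.stepBeta)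

theorem SN.typable_of_subterm {t : Lam} (h : SN StepBeta t) {s : Lam} (hs : Subterm_s2 s t) :
    Typable s := by
  induction h generalizing s with
  | intro t _ ih =>
    refine Subterm_s2.typable_of_typable_reducts (fun u u' hu huu' => ?_) hs
    obtain ⟨t', ht', hu'⟩ := hu.exists_stepBeta huu'
    exact ih t' ht' hu'

end Lam

open Lam in
/-- If a λ-term is strongly normalizing for β-reduction,
then it is typable in system 𝒟. -/
theorem sn_beta_typable (t : Lam) (h : SN StepBeta t) : Typable t :=
  h.typable_of_subterm .refl
end
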